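/- Let (P_n)_{n≥0} be a monic OPS with recurrence coefficients (B_n, C_n) satisfying 𝒟_q(𝒮_q P_n) = r_n P_{n−1} for all n ≥ 0, for some constants r_n ∈ ℂ. Define a_n = r_{n+1} − (4α² − 3)r_n − α, b_n = (B_n − (4α² − 3)B_{n−1})·r_n, c_n = r_{n−1}C_n − (4α² − 3)r_n C_{n−1}. Then for every n ≥ 3: 4α(α² − 1)·(z² − α²)·(𝒮_q(𝒟_q P_n)) = b_n^{[1]} P_{n+1} + b_n^{[2]} P_n + b_n^{[3]} P_{n−1} + b_n^{[4]} P_{n−2} + b_n^{[5]} P_{n−3}, where b_n^{[1]} = a_{n+1} − (2α² − 1)a_n, b_n^{[2]} = b_{n+1} − (2α² − 1)b_n − 2(α² − 1)a_n B_n, b_n^{[3]} = c_{n+1} − (2α² − 1)c_n + (B_n − (2α² − 1)B_{n−1})b_n + (a_{n−1} − (2α² − 1)a_n)C_n, b_n^{[4]} = (B_n − (2α² − 1)B_{n−2})c_n + b_{n−1}C_n − (2α² − 1)b_n C_{n−1}, and b_n^{[5]} = c_{n−1}C_n − (2α² − 1)c_n C_{n−2}. -/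

import Mathlib

open Polynomial

noncomputable section

/-- `q^{1/2}` as a complex number, for a real `q`. -/
def qh (q : ℝ) : ℂ := ((Real.sqrt q : ℝ) : ℂ)

/-- `α = (q^{1/2} + q^{-1/2})/2`. -/
def alp (q : ℝ) : ℂ := (qh q + (qh q)⁻¹) / 2

/-- `α_n = (q^{n/2} + q^{-n/2})/2` (so that `α_{-1} = α`). -/
def alpn (q : ℝ) (n : ℤ) : ℂ := ((qh q) ^ n + (qh q) ^ (-n)) / 2

/-- `γ_n = (q^{n/2} - q^{-n/2})/(q^{1/2} - q^{-1/2})` (so that `γ_{-1} = -1`). -/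
def gamn (q : ℝ) (n : ℤ) : ℂ := ((qh q) ^ n - (qh q) ^ (-n)) / (qh q - (qh q)⁻¹)

/-- `U₂(z) = (α² - 1)(z² - 1)` as a polynomial. -/
def U2 (q : ℝ) : ℂ[X] := Polynomial.C ((alp q) ^ 2 - 1) * (X ^ 2 - 1)

/-- Defining property of the Askey–Wilson operator `𝒟_q` on `ℂ[z]`:
for every `w ≠ 0` with `w² ≠ 1`,
`(𝒟_q p)((w+w⁻¹)/2) = [p((q^{1/2}w+q^{-1/2}w⁻¹)/2) − p((q^{-1/2}w+q^{1/2}w⁻¹)/2)]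
  / (((q^{1/2}−q^{-1/2})/2)(w−w⁻¹))`. -/
def IsAW (q : ℝ) (D : ℂ[X] → ℂ[X]) : Prop :=
  ∀ p : ℂ[X], ∀ w : ℂ, w ≠ 0 → w ^ 2 ≠ 1 →
    (D p).eval ((w + w⁻¹) / 2) =
      (p.eval ((qh q * w + (qh q)⁻¹ * w⁻¹) / 2) -
          p.eval (((qh q)⁻¹ * w + qh q * w⁻¹) / 2)) /
        (((qh q - (qh q)⁻¹) / 2) * (w - w⁻¹))

/-- Defining property of the averaging operator `𝒮_q` on `ℂ[z]`:
for every `w ≠ 0` with `w² ≠ 1`,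
`(𝒮_q p)((w+w⁻¹)/2) = (1/2)[p((q^{1/2}w+q^{-1/2}w⁻¹)/2) + p((q^{-1/2}w+q^{1/2}w⁻¹)/2)]`. -/
def IsAv (q : ℝ) (S : ℂ[X] → ℂ[X]) : Prop :=
  ∀ p : ℂ[X], ∀ w : ℂ, w ≠ 0 → w ^ 2 ≠ 1 →
    (S p).eval ((w + w⁻¹) / 2) =
      (p.eval ((qh q * w + (qh q)⁻¹ * w⁻¹) / 2) +
          p.eval (((qh q)⁻¹ * w + qh q * w⁻¹) / 2)) / 2

/-- A monic orthogonal polynomial sequence with recurrence coefficients `(B_n, C_n)`: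
monic polynomials, `deg P_n = n`, `P_0 = 1` and the three-term recurrence
`P_{n+1} = (z - B_n) P_n - C_n P_{n-1}` (with `P_{-1} = 0`), `C_n ≠ 0` for `n ≥ 1`. -/
structure MonicOPS (P : ℕ → ℂ[X]) (B Co : ℕ → ℂ) : Prop where
  monic : ∀ n, (P n).Monic
  deg : ∀ n, (P n).natDegree = n
  p0 : P 0 = 1
  p1 : P 1 = X - Polynomial.C (B 0)
  ttrr : ∀ n : ℕ,
    P (n + 2) = (X - Polynomial.C (B (n + 1))) * P (n + 1) - Polynomial.C (Co (n + 1)) * P n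
  Cne : ∀ n : ℕ, 1 ≤ n → Co n ≠ 0

/-- The Appell-type property `𝒮_q(𝒟_q P_n) = k_n P_{n-1}` for all `n ≥ 0` (with `P_{-1} = 0`). -/
def AppellSD (Sq Dq : ℂ[X] → ℂ[X]) (P : ℕ → ℂ[X]) (k : ℕ → ℂ) : Prop :=
  Sq (Dq (P 0)) = 0 ∧ ∀ n : ℕ, Sq (Dq (P (n + 1))) = Polynomial.C (k (n + 1)) * P n

/-- The Appell-type property `𝒟_q(𝒮_q P_n) = k_n P_{n-1}` for all `n ≥ 0` (with `P_{-1} = 0`). -/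
def AppellDS (Dq Sq : ℂ[X] → ℂ[X]) (P : ℕ → ℂ[X]) (k : ℕ → ℂ) : Prop :=
  Dq (Sq (P 0)) = 0 ∧ ∀ n : ℕ, Dq (Sq (P (n + 1))) = Polynomial.C (k (n + 1)) * P n

end

noncomputable section

/-- `a_n = r_{n+1} − (4α²−3)r_n − α`. -/
def aN (q : ℝ) (r : ℕ → ℂ) (n : ℕ) : ℂ := r (n + 1) - (4 * (alp q) ^ 2 - 3) * r n - alp q

/-- `b_n = (B_n − (4α²−3)B_{n−1})·r_n`. -/
def bN (q : ℝ) (r B : ℕ → ℂ) (n : ℕ) : ℂ := (B n - (4 * (alp q) ^ 2 - 3) * B (n - 1)) * r n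

/-- `c_n = r_{n−1}C_n − (4α²−3)r_n C_{n−1}`. -/
def cN (q : ℝ) (r Co : ℕ → ℂ) (n : ℕ) : ℂ :=
  r (n - 1) * Co n - (4 * (alp q) ^ 2 - 3) * r n * Co (n - 1)

end

theorem aux_sum (s t w v : ℂ) (hs : s * t = 1) (hw : w * v = 1)
    (F U V SD G H : ℂ) (hd : s - t ≠ 0) (h1 : s * w - t * v ≠ 0) (h2 : t * w - s * v ≠ 0)
    (hG : G = (U - F) / (((s - t) / 2) * (s * w - t * v)))
    (hH : H = (F - V) / (((s - t) / 2) * (t * w - s * v)))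
    (hSD : SD = (G + H) / 2) :
    (s - t) * 4 * (((w + v) / 2) ^ 2 - ((s + t) / 2) ^ 2) * SD =
      (s - t) * 2 * ((w + v) / 2) * F + ((s + t) / 2) * (w - v) * (U - V)
        - (s - t) * ((w + v) / 2) * (U + V) := by
  have e : 4 * (((w + v) / 2) ^ 2 - ((s + t) / 2) ^ 2) =
      (s * w - t * v) * (t * w - s * v) := by
    linear_combination (s ^ 2 + t ^ 2) * hw - (w ^ 2 + v ^ 2) * hs + 2 * hw - 2 * hs
  have hG' : (s - t) * (s * w - t * v) * G = 2 * (U - F) := by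
    rw [hG]; field_simp
  have hH' : (s - t) * (t * w - s * v) * H = 2 * (F - V) := by
    rw [hH]; field_simp
  have : (s - t) * 4 * (((w + v) / 2) ^ 2 - ((s + t) / 2) ^ 2) * SD =
    (s - t) * ((s * w - t * v) * (t * w - s * v)) * SD := by rw [← e]; ring
  rw [this, hSD]
  linear_combination (t * w - s * v) / 2 * hG' + (s * w - t * v) / 2 * hH'

theorem aux_bad (s t w v : ℂ) (hs : s * t = 1) (hw : w * v = 1) (h : (s * w) ^ 2 = 1) :
    ((w + v) / 2) ^ 2 = ((s + t) / 2) ^ 2 := by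
  have e : 4 * (((w + v) / 2) ^ 2 - ((s + t) / 2) ^ 2) =
      (s * w - t * v) * (t * w - s * v) := by
    linear_combination (s ^ 2 + t ^ 2) * hw - (w ^ 2 + v ^ 2) * hs + 2 * hw - 2 * hs
  have h2 : s * w = t * v := by
    have : (s * t) * (w * v) = 1 := by rw [hs, hw, one_mul]
    linear_combination t * v * h - s * w * this
  rw [h2, sub_self, zero_mul] at e
  linear_combination e / 4

theorem inv_sub_ne {a : ℂ} (h0 : a ≠ 0) (h : a ^ 2 ≠ 1) : a - a⁻¹ ≠ 0 := by
  intro h'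
  apply h
  field_simp at h'
  linear_combination h'

theorem SD_eval (q : ℝ) (Dq Sq : ℂ[X] → ℂ[X]) (hD : IsAW q Dq) (hS : IsAv q Sq)
    (p : ℂ[X]) (w : ℂ) (hs0 : qh q ≠ 0) (hd : qh q - (qh q)⁻¹ ≠ 0) (hw : w ≠ 0)
    (hw1 : w ^ 2 ≠ 1) (hw2 : (qh q * w) ^ 2 ≠ 1) (hw3 : ((qh q)⁻¹ * w) ^ 2 ≠ 1) :
    (qh q - (qh q)⁻¹) * 4 * (((w + w⁻¹) / 2) ^ 2 - (alp q) ^ 2) *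
        (Sq (Dq p)).eval ((w + w⁻¹) / 2) =
      (qh q - (qh q)⁻¹) * 2 * ((w + w⁻¹) / 2) * p.eval ((w + w⁻¹) / 2) +
        alp q * (w - w⁻¹) *
          (p.eval ((qh q * (qh q * w) + (qh q)⁻¹ * ((qh q)⁻¹ * w⁻¹)) / 2) -
            p.eval (((qh q)⁻¹ * ((qh q)⁻¹ * w) + qh q * (qh q * w⁻¹)) / 2)) -
        (qh q - (qh q)⁻¹) * ((w + w⁻¹) / 2) *
          (p.eval ((qh q * (qh q * w) + (qh q)⁻¹ * ((qh q)⁻¹ * w⁻¹)) / 2) +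
            p.eval (((qh q)⁻¹ * ((qh q)⁻¹ * w) + qh q * (qh q * w⁻¹)) / 2)) := by
  have a1 := hS (Dq p) w hw hw1
  have a2 := hD p (qh q * w) (mul_ne_zero hs0 hw) hw2
  have a3 := hD p ((qh q)⁻¹ * w) (mul_ne_zero (inv_ne_zero hs0) hw) hw3
  have n2 := inv_sub_ne (mul_ne_zero hs0 hw) hw2
  have n3 := inv_sub_ne (mul_ne_zero (inv_ne_zero hs0) hw) hw3
  simp only [mul_inv, inv_inv, mul_inv_cancel_left₀ hs0, inv_mul_cancel_left₀ hs0] at a2 a3 n2 n3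
  exact aux_sum (qh q) (qh q)⁻¹ w w⁻¹ (mul_inv_cancel₀ hs0) (mul_inv_cancel₀ hw) _ _ _ _ _ _
    hd n2 n3 a2 a3 a1

theorem DS_eval (q : ℝ) (Dq Sq : ℂ[X] → ℂ[X]) (hD : IsAW q Dq) (hS : IsAv q Sq)
    (p : ℂ[X]) (w : ℂ) (hs0 : qh q ≠ 0) (hd : qh q - (qh q)⁻¹ ≠ 0) (hw : w ≠ 0)
    (hw1 : w ^ 2 ≠ 1) (hw2 : (qh q * w) ^ 2 ≠ 1) (hw3 : ((qh q)⁻¹ * w) ^ 2 ≠ 1) :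
    p.eval ((qh q * (qh q * w) + (qh q)⁻¹ * ((qh q)⁻¹ * w⁻¹)) / 2) -
      p.eval (((qh q)⁻¹ * ((qh q)⁻¹ * w) + qh q * (qh q * w⁻¹)) / 2) =
    (qh q - (qh q)⁻¹) * (w - w⁻¹) * (Dq (Sq p)).eval ((w + w⁻¹) / 2) := by
  have a1 := hD (Sq p) w hw hw1
  have a2 := hS p (qh q * w) (mul_ne_zero hs0 hw) hw2
  have a3 := hS p ((qh q)⁻¹ * w) (mul_ne_zero (inv_ne_zero hs0) hw) hw3
  have n1 := inv_sub_ne hw hw1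
  simp only [mul_inv, inv_inv, mul_inv_cancel_left₀ hs0, inv_mul_cancel_left₀ hs0] at a2 a3
  rw [a1, a2, a3]
  generalize qh q - (qh q)⁻¹ = d at *
  generalize w - w⁻¹ = e at *
  field_simp
  ring

theorem eq_of_good (q : ℝ) (f g : ℂ[X]) (hs0 : qh q ≠ 0)
    (h : ∀ w : ℂ, w ≠ 0 → w ^ 2 ≠ 1 → (qh q * w) ^ 2 ≠ 1 → ((qh q)⁻¹ * w) ^ 2 ≠ 1 →
      f.eval ((w + w⁻¹) / 2) = g.eval ((w + w⁻¹) / 2)) : f = g := by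
  apply Polynomial.eq_of_infinite_eval_eq
  have hfin : ({1, -1, alp q, -alp q} : Set ℂ).Finite := by simp
  refine hfin.infinite_compl.mono ?_
  intro z hz
  simp only [Set.mem_compl_iff, Set.mem_insert_iff, Set.mem_singleton_iff, not_or] at hz
  obtain ⟨z1, z2, z3, z4⟩ := hz
  have m1 : z ^ 2 ≠ 1 := by
    intro h'
    rcases (sq_eq_sq_iff_eq_or_eq_neg.mp (h'.trans (one_pow 2).symm)) with h' | h' <;> contradiction
  have m2 : z ^ 2 ≠ (alp q) ^ 2 := by
    intro h'
    rcases sq_eq_sq_iff_eq_or_eq_neg.mp h' with h' | h' <;> contradiction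
  obtain ⟨c, hc⟩ := IsAlgClosed.exists_pow_nat_eq (z ^ 2 - 1) (n := 2) (by norm_num)
  have hwv : (z + c) * (z - c) = 1 := by linear_combination -hc
  have hw : z + c ≠ 0 := left_ne_zero_of_mul_eq_one hwv
  have hv : (z + c)⁻¹ = z - c := inv_eq_of_mul_eq_one_right hwv
  have hx : ((z + c) + (z + c)⁻¹) / 2 = z := by rw [hv]; ring
  have hst : qh q * (qh q)⁻¹ = 1 := mul_inv_cancel₀ hs0
  have key := h (z + c) hw ?_ ?_ ?_
  · rw [hx] at key
    exact key
  · intro h'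
    apply m1
    have : z - c = z + c := by
      linear_combination (z + c) * hwv - (z - c) * h'
    have hc0 : c = 0 := by linear_combination -this / 2
    rw [hc0] at hc
    linear_combination -hc
  · intro h'
    apply m2
    rw [← hx, hv]
    exact aux_bad _ _ _ _ hst hwv h'
  · intro h'
    apply m2
    rw [← hx, hv, alp, add_comm (qh q)]
    exact aux_bad _ _ _ _ (by rw [mul_comm]; exact hst) hwv h'

/-- for a monic OPS with `𝒟_q(𝒮_q P_n) = r_n P_{n-1}`, for every `n ≥ 3`,
`4α(α²−1)(z²−α²)·𝒮_q(𝒟_q P_n) = b_n^{[1]} P_{n+1} + b_n^{[2]} P_n + b_n^{[3]} P_{n−1}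
 + b_n^{[4]} P_{n−2} + b_n^{[5]} P_{n−3}`. -/
theorem stmt_14 (q : ℝ) (hq0 : 0 < q) (hq1 : q < 1)
    (Dq Sq : ℂ[X] → ℂ[X]) (hD : IsAW q Dq) (hS : IsAv q Sq)
    (P : ℕ → ℂ[X]) (B Co : ℕ → ℂ) (hops : MonicOPS P B Co)
    (r : ℕ → ℂ) (hAp : AppellDS Dq Sq P r) :
    ∀ n : ℕ, 3 ≤ n →
      Polynomial.C (4 * alp q * ((alp q) ^ 2 - 1)) *
        (X ^ 2 - Polynomial.C ((alp q) ^ 2)) * Sq (Dq (P n)) =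
        Polynomial.C (aN q r (n + 1) - (2 * (alp q) ^ 2 - 1) * aN q r n) * P (n + 1) +
        Polynomial.C (bN q r B (n + 1) - (2 * (alp q) ^ 2 - 1) * bN q r B n -
          2 * ((alp q) ^ 2 - 1) * aN q r n * B n) * P n +
        Polynomial.C (cN q r Co (n + 1) - (2 * (alp q) ^ 2 - 1) * cN q r Co n +
          (B n - (2 * (alp q) ^ 2 - 1) * B (n - 1)) * bN q r B n +
          (aN q r (n - 1) - (2 * (alp q) ^ 2 - 1) * aN q r n) * Co n) * P (n - 1) +
        Polynomial.C ((B n - (2 * (alp q) ^ 2 - 1) * B (n - 2)) * cN q r Co n +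
          bN q r B (n - 1) * Co n - (2 * (alp q) ^ 2 - 1) * bN q r B n * Co (n - 1)) *
          P (n - 2) +
        Polynomial.C (cN q r Co (n - 1) * Co n -
          (2 * (alp q) ^ 2 - 1) * cN q r Co n * Co (n - 2)) * P (n - 3) := by
  have hs : (0:ℝ) < Real.sqrt q := Real.sqrt_pos.mpr hq0
  have hs0 : qh q ≠ 0 := by
    unfold qh; exact_mod_cast hs.ne'
  have hs1 : (qh q) ^ 2 ≠ 1 := by
    unfold qh
    have : Real.sqrt q ^ 2 = q := Real.sq_sqrt hq0.le
    rw [← Complex.ofReal_pow, this]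
    exact_mod_cast hq1.ne
  have hd := inv_sub_ne hs0 hs1
  intro n hn
  obtain ⟨m, rfl⟩ : ∃ m, n = m + 3 := ⟨n - 3, by omega⟩
  apply eq_of_good q _ _ hs0
  intro w hw hw1 hw2 hw3
  have hy := inv_sub_ne hw hw1
  have hSD := SD_eval q Dq Sq hD hS (P (m + 3)) w hs0 hd hw hw1 hw2 hw3
  have hDS : ∀ k, _ := fun k => DS_eval q Dq Sq hD hS (P (k + 1)) w hs0 hd hw hw1 hw2 hw3
  simp only [hAp.2, eval_mul, eval_C] at hDS
  have hrec : ∀ k z, z * (P (k + 1)).eval z = (P (k + 2)).eval z + B (k + 1) * (P (k + 1)).eval z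
      + Co (k + 1) * (P k).eval z := by
    intro k z
    rw [hops.ttrr k]
    simp only [eval_sub, eval_mul, eval_C, eval_X]
    ring
  have hsum : (qh q * (qh q * w) + (qh q)⁻¹ * ((qh q)⁻¹ * w⁻¹)) / 2 +
      ((qh q)⁻¹ * ((qh q)⁻¹ * w) + qh q * (qh q * w⁻¹)) / 2 =
      2 * (2 * (alp q) ^ 2 - 1) * ((w + w⁻¹) / 2) := by
    unfold alp; field_simp; ring
  have hprod : ((qh q * (qh q * w) + (qh q)⁻¹ * ((qh q)⁻¹ * w⁻¹)) / 2) *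
      (((qh q)⁻¹ * ((qh q)⁻¹ * w) + qh q * (qh q * w⁻¹)) / 2) =
      ((w + w⁻¹) / 2) ^ 2 + (2 * (alp q) ^ 2 - 1) ^ 2 - 1 := by
    unfold alp; field_simp; ring
  have hdiff : (qh q * (qh q * w) + (qh q)⁻¹ * ((qh q)⁻¹ * w⁻¹)) / 2 -
      ((qh q)⁻¹ * ((qh q)⁻¹ * w) + qh q * (qh q * w⁻¹)) / 2 =
      alp q * (qh q - (qh q)⁻¹) * (w - w⁻¹) := by
    unfold alp; field_simp; ring
  have hyy : (w - w⁻¹) ^ 2 = 4 * (((w + w⁻¹) / 2) ^ 2 - 1) := by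
    field_simp; ring
  generalize (qh q * (qh q * w) + (qh q)⁻¹ * ((qh q)⁻¹ * w⁻¹)) / 2 = xp at *
  generalize ((qh q)⁻¹ * ((qh q)⁻¹ * w) + qh q * (qh q * w⁻¹)) / 2 = xm at *
  generalize (w + w⁻¹) / 2 = x at *
  generalize w - w⁻¹ = y at *
  generalize qh q - (qh q)⁻¹ = d at *
  -- first order
  have H1 : ∀ k, xp * (P (k + 2)).eval xp - xm * (P (k + 2)).eval xm =
      d * y * (r (k + 3) * (P (k + 2)).eval x + B (k + 2) * (r (k + 2) * (P (k + 1)).eval x)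
        + Co (k + 2) * (r (k + 1) * (P k).eval x)) := by
    intro k
    linear_combination hrec (k + 1) xp - hrec (k + 1) xm + hDS (k + 2) + B (k + 2) * hDS (k + 1)
      + Co (k + 2) * hDS k
  have H0 := hDS (m + 2)
  have H1m := H1 (m + 1)
  have H2 : xp * (xp * (P (m + 3)).eval xp) - xm * (xm * (P (m + 3)).eval xm) =
      d * y * ((r (m + 5) * (P (m + 4)).eval x + B (m + 4) * (r (m + 4) * (P (m + 3)).eval x)
        + Co (m + 4) * (r (m + 3) * (P (m + 2)).eval x)) + B (m + 3) *
        (r (m + 4) * (P (m + 3)).eval x + B (m + 3) * (r (m + 3) * (P (m + 2)).eval x)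
        + Co (m + 3) * (r (m + 2) * (P (m + 1)).eval x)) + Co (m + 3) *
        (r (m + 3) * (P (m + 2)).eval x + B (m + 2) * (r (m + 2) * (P (m + 1)).eval x)
        + Co (m + 2) * (r (m + 1) * (P m).eval x))) := by
    linear_combination xp * hrec (m + 2) xp - xm * hrec (m + 2) xm + H1 (m + 2)
      + B (m + 3) * H1 (m + 1) + Co (m + 3) * H1 m
  have R2 := hrec (m + 2) x
  have R1 := hrec (m + 1) x
  have R0 := hrec m x
  simp only [eval_mul, eval_add, eval_sub, eval_C, eval_X, eval_pow, aN, bN, cN,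
    show m + 3 - 1 = m + 2 from rfl, show m + 3 - 2 = m + 1 from rfl,
    show m + 3 - 3 = m from rfl, show m + 3 + 1 = m + 4 from rfl,
    show m + 4 - 1 = m + 3 from rfl, show m + 2 + 1 = m + 3 from rfl,
    show m + 4 + 1 = m + 5 from rfl, show m + 2 - 1 = m + 1 from rfl] at *
  generalize alp q = α at *
  have hdy : d * y ≠ 0 := mul_ne_zero hd hy
  set T1 := r (m + 4) * (P (m + 3)).eval x + B (m + 3) * (r (m + 3) * (P (m + 2)).eval x)
        + Co (m + 3) * (r (m + 2) * (P (m + 1)).eval x) with hT1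
  have E1 : α * ((P (m + 3)).eval xp + (P (m + 3)).eval xm) =
      2 * T1 - 2 * (2 * α ^ 2 - 1) * x * (r (m + 3) * (P (m + 2)).eval x) := by
    apply mul_left_cancel₀ hdy
    linear_combination -((P (m + 3)).eval xp + (P (m + 3)).eval xm) * hdiff + 2 * H1m
      - 2 * (2 * α ^ 2 - 1) * x * H0
      - ((P (m + 3)).eval xp - (P (m + 3)).eval xm) * hsum
  have E3 := H2
  rw [show xp * (xp * (P (m + 3)).eval xp) - xm * (xm * (P (m + 3)).eval xm) = d * y *
      (2 * (2 * α ^ 2 - 1) * x * T1 - (x ^ 2 + (2 * α ^ 2 - 1) ^ 2 - 1) *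
        (r (m + 3) * (P (m + 2)).eval x)) by
    linear_combination 2 * (2 * α ^ 2 - 1) * x * H1m
      - (x ^ 2 + (2 * α ^ 2 - 1) ^ 2 - 1) * H0
      + (xp * (P (m + 3)).eval xp - xm * (P (m + 3)).eval xm) * hsum
      - ((P (m + 3)).eval xp - (P (m + 3)).eval xm) * hprod] at E3
  have E3' := mul_left_cancel₀ hdy E3
  have ESD : 4 * α * (x ^ 2 - α ^ 2) * (Sq (Dq (P (m + 3)))).eval x =
      2 * α * x * (P (m + 3)).eval x + 4 * α ^ 2 * (x ^ 2 - 1) * (r (m + 3) * (P (m + 2)).eval x)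
      - x * (2 * T1 - 2 * (2 * α ^ 2 - 1) * x * (r (m + 3) * (P (m + 2)).eval x)) := by
    apply mul_left_cancel₀ hd
    linear_combination α * hSD + α ^ 2 * y * H0 - d * x * E1
      + d * α ^ 2 * (r (m + 3) * (P (m + 2)).eval x) * hyy
  clear_value T1
  subst hT1
  linear_combination (α ^ 2 - 1) * ESD + E3'
    + (2 * α ^ 2 - 1) * (4 * α ^ 2 - 3) * x * r (m + 3) * R1
    - ((4 * α ^ 2 - 3) * r (m + 4) + α
        + (2 * α ^ 2 - 1) * (r (m + 4) - (4 * α ^ 2 - 3) * r (m + 3) - α)) * R2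
    - ((4 * α ^ 2 - 3) * B (m + 3) * r (m + 3)
        + (2 * α ^ 2 - 1) * ((B (m + 3) - (4 * α ^ 2 - 3) * B (m + 2)) * r (m + 3))) * R1
    - ((4 * α ^ 2 - 3) * Co (m + 3) * r (m + 2) + (2 * α ^ 2 - 1) *
        (r (m + 2) * Co (m + 3) - (4 * α ^ 2 - 3) * r (m + 3) * Co (m + 2))) * R0
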